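/- arXiv:1609.01602 — 3 statements merged into one kernel-verified Lean document; each statement's English description precedes it below -/
import Mathlib

section
/- Suppose r ≥ s and (r, s, ρ, m) is in the surjective range, i.e. choose(r+m, m) ≥ m·d − g + 1 where g = (r+1)·s + ρ and d = g + r − s. Then (r+1, s, ρ, m) is also in the surjective range: setting g' = (r+2)·s + ρ and d' = g' + (r+1) − s, one has choose(r+1+m, m) ≥ m·d' − g' + 1. -/
theorem Nat.mul_succ_add_one_le_choose (r k : ℕ) :
    k * (r + 1) + 1 ≤ (r + k + 1).choose k := by
  induction k with
  | zero => simp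
  | succ k ih =>
    have h : r + 1 ≤ (r + k + 1).choose (k + 1) := calc
      r + 1 = (r + 1).choose r := (Nat.choose_succ_self_right r).symm
      _ ≤ (r + k + 1).choose r := Nat.choose_le_choose r (by omega)
      _ = (r + k + 1).choose (k + 1) := Nat.choose_symm_of_eq_add (by omega)
    have hp : (r + (k + 1) + 1).choose (k + 1) =
        (r + k + 1).choose k + (r + k + 1).choose (k + 1) := Nat.choose_succ_succ _ _
    rw [hp, Nat.succ_mul]
    omega

/-- If `r ≥ s` and `(r, s, ρ, m)` is in the surjective range, i.e.
`choose(r+m, m) ≥ m·d − g + 1` where `g = (r+1)·s + ρ` and `d = g + r − s`, then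
`(r+1, s, ρ, m)` is also in the surjective range: with `g' = (r+2)·s + ρ` and
`d' = g' + (r+1) − s`, one has `choose(r+1+m, m) ≥ m·d' − g' + 1`. -/
theorem stmt_3 (r s ρ m : ℕ) (hr : 3 ≤ r) (hs : 1 ≤ s) (hm : 1 ≤ m) (hrs : s ≤ r)
    (h : m * (((r + 1) * s + ρ : ℤ) + r - s) - ((r + 1) * s + ρ) + 1 ≤
      ((r + m).choose m : ℤ)) :
    m * (((r + 2) * s + ρ : ℤ) + (r + 1) - s) - ((r + 2) * s + ρ) + 1 ≤
      ((r + 1 + m).choose m : ℤ) := by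
  obtain ⟨k, rfl⟩ : ∃ k, m = k + 1 := ⟨m - 1, by omega⟩
  have hp : (r + 1 + (k + 1)).choose (k + 1) =
      (r + k + 1).choose k + (r + (k + 1)).choose (k + 1) := by
    rw [show r + 1 + (k + 1) = r + k + 1 + 1 by ring]
    exact Nat.choose_succ_succ _ _
  have hk : (k * (r + 1) + 1 : ℤ) ≤ (r + k + 1).choose k := by
    exact_mod_cast Nat.mul_succ_add_one_le_choose r k
  have hks : (k * s : ℤ) ≤ k * r := by exact_mod_cast Nat.mul_le_mul_left k hrs
  rw [hp]
  push_cast at h ⊢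
  linarith
end

section
/- Let g, r, d, m be integers with r ≥ 3, m ≥ 2, d < g + r, and g ≥ (r+1)(g − d + r). If (g, r, d, m) is in the surjective range, i.e. choose(r+m, m) ≥ m·d − g + 1, then (g, r, d, m+1) is also in the surjective range, i.e. choose(r+m+1, m+1) ≥ (m+1)·d − g + 1. -/
/-- Let `g, r, d, m` be integers with `r ≥ 3`, `m ≥ 2`, `d < g + r`, and
`g ≥ (r+1)(g − d + r)`.  If `(g, r, d, m)` is in the surjective range, i.e.
`choose(r+m, m) ≥ m·d − g + 1`, then `(g, r, d, m+1)` is also in the surjective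
range, i.e. `choose(r+m+1, m+1) ≥ (m+1)·d − g + 1`. -/
theorem stmt_4 (g r d m : ℤ) (hr : 3 ≤ r) (hm : 2 ≤ m) (hd : d < g + r)
    (hg : (r + 1) * (g - d + r) ≤ g)
    (h : m * d - g + 1 ≤ ((r + m).toNat.choose m.toNat : ℤ)) :
    (m + 1) * d - g + 1 ≤ ((r + m + 1).toNat.choose (m + 1).toNat : ℤ) := by
  lift r to ℕ using by omega
  lift m to ℕ using by omega
  have e₁ : ((r : ℤ) + m).toNat = r + m := by omega
  have e₂ : ((r : ℤ) + m + 1).toNat = r + m + 1 := by omega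
  have e₃ : ((m : ℤ) + 1).toNat = m + 1 := by omega
  rw [e₁, Int.toNat_natCast] at h
  rw [e₂, e₃, Nat.choose_succ_succ', Nat.cast_add]
  have hC : ((r + m).choose (m + 1) : ℤ) * (m + 1) = (r + m).choose m * r := by
    have := Nat.choose_succ_right_eq (r + m) m
    rw [Nat.add_sub_cancel] at this
    exact_mod_cast this
  by_cases hrm : r = 3 ∧ m = 2
  · obtain ⟨rfl, rfl⟩ := hrm
    norm_num [Nat.choose] at *
    omega
  generalize ((r + m).choose m : ℤ) = a at *
  generalize ((r + m).choose (m + 1) : ℤ) = b at *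
  -- It suffices that `d ≤ b`; multiply `h` by `r` and bound `r * (g - d + r)` by `d - r`.
  suffices d ≤ b by linarith
  have hd₀ : 0 ≤ d := by nlinarith
  have hk : 0 ≤ ((r : ℤ) - 1) * (m - 1) - 3 := by
    rcases (by omega : 4 ≤ r ∨ 3 ≤ m) with h' | h'
    · have : (4 : ℤ) ≤ r := by exact_mod_cast h'
      nlinarith
    · have : (3 : ℤ) ≤ m := by exact_mod_cast h'
      nlinarith
  have hra := mul_le_mul_of_nonneg_right h (by omega : (0 : ℤ) ≤ r)
  have hkd := mul_nonneg hk hd₀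
  refine le_of_mul_le_mul_right ?_ (by omega : (0 : ℤ) < m + 1)
  nlinarith
end

section
/- For every integer m ≥ 2 and any two distinct triples (a, b, c) and (a', b', c') in A_m: if 3a + b = 3a' + b', then this common value is at most m; and if 3a + 2b = 3a' + 2b', then this common value is at least 2m. -/
/-- The recursively defined family `A_m` of multisets of size `m` on `{0, 1, 2}`,
encoded as triples `(a, b, c)` of multiplicities: `A_2` consists of all six triples
with `a + b + c = 2`, and for `m ≥ 2`,
`A_{m+1} = {(a, b+1, c) : (a, b, c) ∈ A_m} ∪ {(m+1,0,0), (m,0,1), (1,0,m), (0,0,m+1)}`. -/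
def A : ℕ → Finset (ℕ × ℕ × ℕ)
  | 0 => ∅
  | 1 => ∅
  | 2 => {(2, 0, 0), (1, 1, 0), (1, 0, 1), (0, 2, 0), (0, 1, 1), (0, 0, 2)}
  | (m + 3) =>
      ((A (m + 2)).image fun p => (p.1, p.2.1 + 1, p.2.2)) ∪
        {(m + 3, 0, 0), (m + 2, 0, 1), (1, 0, m + 2), (0, 0, m + 3)}

/-- Triples in `A m` have size `m`, and the multiplicity of `0` or that of `2` is at most one. -/
theorem sum_eq_and_le_one_of_mem_A {m : ℕ} {p : ℕ × ℕ × ℕ} (hp : p ∈ A m) :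
    p.1 + p.2.1 + p.2.2 = m ∧ (p.1 ≤ 1 ∨ p.2.2 ≤ 1) := by
  induction m using A.induct generalizing p with
  | case1 => simp [A] at hp
  | case2 => simp [A] at hp
  | case3 =>
    simp only [A, Finset.mem_insert, Finset.mem_singleton] at hp
    rcases hp with rfl | rfl | rfl | rfl | rfl | rfl <;> simp
  | case4 m ih =>
    simp only [A, Finset.mem_union, Finset.mem_image, Finset.mem_insert,
      Finset.mem_singleton] at hp
    rcases hp with ⟨q, hq, rfl⟩ | rfl | rfl | rfl | rfl
    · have := ih hq
      dsimp only
      omega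
    all_goals dsimp only; omega

/-- For every `m ≥ 2` and any two distinct triples `(a, b, c)` and `(a', b', c')` in
`A_m`: if `3a + b = 3a' + b'`, then this common value is at most `m`; and if
`3a + 2b = 3a' + 2b'`, then this common value is at least `2m`. -/
theorem stmt_15 (m : ℕ) (hm : 2 ≤ m) (p q : ℕ × ℕ × ℕ)
    (hp : p ∈ A m) (hq : q ∈ A m) (hpq : p ≠ q) :
    (3 * p.1 + p.2.1 = 3 * q.1 + q.2.1 → 3 * p.1 + p.2.1 ≤ m) ∧
    (3 * p.1 + 2 * p.2.1 = 3 * q.1 + 2 * q.2.1 → 2 * m ≤ 3 * p.1 + 2 * p.2.1) := by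
  obtain ⟨a, b, c⟩ := p
  obtain ⟨a', b', c'⟩ := q
  have h₁ := sum_eq_and_le_one_of_mem_A hp
  have h₂ := sum_eq_and_le_one_of_mem_A hq
  simp only [ne_eq, Prod.mk.injEq] at h₁ h₂ hpq ⊢
  omega
end
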